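/- The series ∑_{n=0}^∞ C(2n,n)² · P_n(19/13) · (65/20736)^n · (97756868n³ − 24254580n² − 539415n − 264590) converges to 6065280/π. -/

import Mathlib

open Real Filter

/-- The Legendre polynomial of degree `n`, given by the explicit formula
`P_n(x) = 2^{-n} ∑_{j=0}^{n} C(n,j)^2 (x-1)^{n-j} (x+1)^j`. -/
noncomputable def legendreP (n : ℕ) (x : ℝ) : ℝ :=
  (2 : ℝ)⁻¹ ^ n *
    ∑ j ∈ Finset.range (n + 1), (n.choose j : ℝ) ^ 2 * (x - 1) ^ (n - j) * (x + 1) ^ j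

/-- The power series `∑ nᵏ g(n) zⁿ`, obtained from `∑ g(n) zⁿ` by applying `z d/dz` `k` times. -/
noncomputable def eulerSeries (g : ℕ → ℝ) (k : ℕ) (z : ℝ) : ℝ :=
  ∑' n : ℕ, (n : ℝ) ^ k * g n * z ^ n

lemma norm_eulerSeries_term_le {g : ℕ → ℝ} {K : ℝ} (hg : ∀ n, |g n| ≤ K ^ n) (k n : ℕ)
    {z r : ℝ} (hz : |z| ≤ r) :
    ‖(n : ℝ) ^ k * g n * z ^ n‖ ≤ (n : ℝ) ^ k * (K * r) ^ n := by
  rw [norm_mul, norm_mul, norm_pow, norm_pow, mul_pow, mul_assoc]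
  simp only [Real.norm_eq_abs, Nat.abs_cast]
  have := (abs_nonneg (g n)).trans (hg n)
  gcongr
  exact hg n

lemma summable_eulerSeries {g : ℕ → ℝ} {K : ℝ} (hK : 0 < K) (hg : ∀ n, |g n| ≤ K ^ n) (k : ℕ)
    {z : ℝ} (hz : K * |z| < 1) : Summable fun n : ℕ => (n : ℝ) ^ k * g n * z ^ n := by
  refine Summable.of_norm_bounded (g := fun n : ℕ => (n : ℝ) ^ k * (K * |z|) ^ n) ?_
    fun n => norm_eulerSeries_term_le hg k n le_rfl
  refine summable_pow_mul_geometric_of_norm_lt_one k ?_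
  rwa [Real.norm_eq_abs, abs_of_nonneg (by positivity)]

lemma hasDerivAt_eulerSeries {g : ℕ → ℝ} {K : ℝ} (hK : 0 < K) (hg : ∀ n, |g n| ≤ K ^ n) (k : ℕ)
    {z : ℝ} (hz0 : 0 < z) (hz : K * z < 1) :
    HasDerivAt (eulerSeries g k) (eulerSeries g (k + 1) z / z) z := by
  obtain ⟨r, hzr, hr⟩ : ∃ r, z < r ∧ r < 1 / K :=
    exists_between (by rw [lt_div_iff₀ hK]; linarith)
  rw [lt_div_iff₀ hK] at hr
  have hr0 : 0 < r := hz0.trans hzr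
  have hsum : Summable fun n : ℕ => (n : ℝ) ^ (k + 1) * (K * r) ^ n / (z / 2) := by
    have hn : ‖K * r‖ < 1 := by
      rw [Real.norm_eq_abs, abs_of_nonneg (by positivity)]
      linarith
    exact (summable_pow_mul_geometric_of_norm_lt_one (k + 1) hn).div_const _
  have := hasDerivAt_tsum_of_isPreconnected
    (u := fun n : ℕ => (n : ℝ) ^ (k + 1) * (K * r) ^ n / (z / 2))
    (g := fun (n : ℕ) (y : ℝ) => (n : ℝ) ^ k * g n * y ^ n)
    (g' := fun (n : ℕ) (y : ℝ) => (n : ℝ) ^ (k + 1) * g n * y ^ n / y)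
    (t := Set.Ioo (z / 2) r) (y₀ := z) (y := z) hsum isOpen_Ioo isPreconnected_Ioo ?_ ?_
    ⟨by linarith, hzr⟩ (summable_eulerSeries hK hg k (by rwa [abs_of_pos hz0]))
    ⟨by linarith, hzr⟩
  · rwa [tsum_div_const] at this
  · intro n y hy
    have hy0 : y ≠ 0 := by have := hy.1; intro h; linarith
    refine ((hasDerivAt_pow n y).const_mul ((n : ℝ) ^ k * g n)).congr_deriv ?_
    rcases n with _ | n
    · simp
    · rw [Nat.add_sub_cancel]
      field_simp
      ring
  · intro n y hy
    have hy0 : 0 < y := by linarith [hy.1]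
    rw [norm_div]
    have h1 := norm_eulerSeries_term_le hg (k + 1) n (z := y) (r := r)
      (by rw [abs_of_pos hy0]; exact hy.2.le)
    rw [Real.norm_eq_abs y, abs_of_pos hy0]
    have := hy.1.le
    gcongr

lemma continuousOn_eulerSeries {g : ℕ → ℝ} {K r : ℝ} (hK : 0 < K) (hg : ∀ n, |g n| ≤ K ^ n)
    (k : ℕ) (hr : 0 ≤ r) (hKr : K * r < 1) :
    ContinuousOn (eulerSeries g k) (Set.Icc 0 r) := by
  refine continuousOn_tsum (u := fun n : ℕ => (n : ℝ) ^ k * (K * r) ^ n)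
    (fun n => by fun_prop) ?_ fun n x hx =>
      norm_eulerSeries_term_le hg k n (by rw [abs_of_nonneg hx.1]; exact hx.2)
  refine summable_pow_mul_geometric_of_norm_lt_one k ?_
  rwa [Real.norm_eq_abs, abs_of_nonneg (by positivity)]

lemma eulerSeries_zero_left (g : ℕ → ℝ) : eulerSeries g 0 0 = g 0 := by
  unfold eulerSeries
  rw [tsum_eq_single 0 fun n hn => by simp [hn]]
  simp

lemma eulerSeries_succ_zero (g : ℕ → ℝ) (k : ℕ) : eulerSeries g (k + 1) 0 = 0 := by
  unfold eulerSeries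
  refine (tsum_congr fun n => ?_).trans tsum_zero
  rcases n with _ | n <;> simp

/-- Abel summation: if `d n → l` then `(1 - x) ∑ d n xⁿ → l` as `x → 1⁻`. -/
lemma tendsto_one_sub_mul_tsum {d : ℕ → ℝ} {l C : ℝ} (hd : Tendsto d atTop (nhds l))
    (hC : ∀ n, |d n| ≤ C) :
    Tendsto (fun x => (1 - x) * ∑' n : ℕ, d n * x ^ n) (nhdsWithin 1 (Set.Iio 1)) (nhds l) := by
  let f : ℕ → ℝ := fun n => Nat.casesOn n (d 0) fun m => d (m + 1) - d m
  have hf : ∀ n, ∑ i ∈ Finset.range (n + 1), f i = d n := by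
    intro n
    induction n with
    | zero => simp [f]
    | succ n ih => rw [Finset.sum_range_succ, ih]; simp [f]
  have hlim : Tendsto (fun n => ∑ i ∈ Finset.range n, f i) atTop (nhds l) := by
    rw [← tendsto_add_atTop_iff_nat 1]
    simpa only [hf] using hd
  refine (Real.tendsto_tsum_powerSeries_nhdsWithin_lt hlim).congr' ?_
  have hpos : ∀ᶠ x : ℝ in nhdsWithin 1 (Set.Iio 1), 0 < x :=
    nhdsWithin_le_nhds (lt_mem_nhds one_pos)
  filter_upwards [hpos, self_mem_nhdsWithin] with x hx0 hx1
  have hs : Summable fun n => d n * x ^ n := by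
    refine Summable.of_norm_bounded (g := fun n => C * x ^ n)
      ((summable_geometric_of_lt_one hx0.le hx1).mul_left C) fun n => ?_
    rw [norm_mul, norm_pow, Real.norm_eq_abs, Real.norm_eq_abs, abs_of_pos hx0]
    gcongr
    exact hC n
  have hs1 : Summable fun n => d (n + 1) * x ^ (n + 1) := (summable_nat_add_iff 1).2 hs
  have hs2 : Summable fun n => d n * x ^ (n + 1) := by
    simpa only [pow_succ, mul_assoc] using hs.mul_right x
  have hfs : Summable fun n => f n * x ^ n := by
    rw [← summable_nat_add_iff 1]
    simpa only [f, sub_mul] using hs1.sub hs2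
  rw [hfs.tsum_eq_zero_add]
  have e1 : ∑' n, f (n + 1) * x ^ (n + 1)
      = ∑' n, d (n + 1) * x ^ (n + 1) - ∑' n, d n * x ^ (n + 1) := by
    rw [← hs1.tsum_sub hs2]
    simp only [f, sub_mul]
  have e2 : ∑' n, d n * x ^ (n + 1) = (∑' n, d n * x ^ n) * x := by
    rw [← tsum_mul_right]
    simp only [pow_succ, mul_assoc]
  rw [e1, e2, sub_mul, one_mul]
  nth_rewrite 2 [hs.tsum_eq_zero_add]
  change d 0 * x ^ 0 + _ = _
  ring

lemma eq_of_hasDerivAt_zero {f : ℝ → ℝ} {a b : ℝ} (hab : a < b)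
    (hc : ContinuousOn f (Set.Icc a b)) (hf : ∀ x ∈ Set.Ioo a b, HasDerivAt f 0 x) :
    f b = f a := by
  obtain ⟨c, -, h⟩ := exists_hasDerivAt_eq_slope f (fun _ => 0) hab hc hf
  have : b - a ≠ 0 := sub_ne_zero.2 hab.ne'
  field_simp at h
  linarith

/-- The coefficients `C(2n,n)² / 16ⁿ` of the hypergeometric series `₂F₁(1/2, 1/2; 1; m)`. -/
noncomputable def ellCoeff (n : ℕ) : ℝ := (n.centralBinom : ℝ) ^ 2 / 16 ^ n

lemma ellCoeff_nonneg (n : ℕ) : 0 ≤ ellCoeff n := by unfold ellCoeff; positivity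

lemma ellCoeff_zero : ellCoeff 0 = 1 := by simp [ellCoeff]

lemma succ_sq_mul_ellCoeff_succ (n : ℕ) :
    ((n : ℝ) + 1) ^ 2 * ellCoeff (n + 1) = ((n : ℝ) + 1 / 2) ^ 2 * ellCoeff n := by
  have h : ((n : ℝ) + 1) * ((n + 1).centralBinom : ℝ) = 2 * (2 * n + 1) * n.centralBinom := by
    exact_mod_cast Nat.succ_mul_centralBinom_succ n
  unfold ellCoeff
  rw [← mul_div_assoc, ← mul_pow, h, pow_succ]
  field_simp
  ring

lemma ellCoeff_le_one (n : ℕ) : ellCoeff n ≤ 1 := by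
  induction n with
  | zero => simp [ellCoeff]
  | succ n ih =>
    have h := succ_sq_mul_ellCoeff_succ n
    have h0 := ellCoeff_nonneg n
    have hn : (0 : ℝ) ≤ n := n.cast_nonneg
    have h1 : ((n : ℝ) + 1 / 2) ^ 2 * ellCoeff n ≤ ((n : ℝ) + 1) ^ 2 * 1 := by gcongr; norm_num
    rw [← h] at h1
    exact le_of_mul_le_mul_left h1 (by positivity)

lemma abs_ellCoeff_le (n : ℕ) : |ellCoeff n| ≤ 1 ^ n := by
  rw [abs_of_nonneg (ellCoeff_nonneg n), one_pow]
  exact ellCoeff_le_one n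

lemma ellCoeff_eq_wallis (n : ℕ) : ellCoeff n = (Real.Wallis.W n)⁻¹ / (2 * n + 1) := by
  have h : (n.centralBinom : ℝ) * ((n.factorial : ℝ) * n.factorial) = (2 * n).factorial := by
    have := Nat.choose_mul_factorial_mul_factorial (show n ≤ 2 * n by omega)
    rw [show 2 * n - n = n by omega, mul_assoc] at this
    exact_mod_cast this
  rw [Real.Wallis.W_eq_factorial_ratio, ← h, ellCoeff, pow_mul]
  have : (n.factorial : ℝ) ≠ 0 := by positivity
  have : (n.centralBinom : ℝ) ≠ 0 := by exact_mod_cast n.centralBinom_ne_zero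
  norm_num
  field_simp

lemma tendsto_mul_ellCoeff : Tendsto (fun n : ℕ => (n : ℝ) * ellCoeff n) atTop (nhds (1 / π)) := by
  have h1 := Real.Wallis.tendsto_W_nhds_pi_div_two.inv₀ (by positivity)
  have h2 : Tendsto (fun n : ℕ => (n : ℝ) / (2 * n + 1)) atTop (nhds (1 / 2)) := by
    have h3 : Tendsto (fun n : ℕ => 2 + ((n : ℝ))⁻¹) atTop (nhds (2 + 0)) :=
      tendsto_const_nhds.add (tendsto_inv_atTop_zero.comp tendsto_natCast_atTop_atTop)
    rw [add_zero] at h3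
    rw [one_div]
    refine (h3.inv₀ two_ne_zero).congr' ?_
    filter_upwards [eventually_gt_atTop 0] with n hn
    have : (0 : ℝ) < n := by exact_mod_cast hn
    field_simp
  convert h2.mul h1 using 1
  · ext n
    rw [ellCoeff_eq_wallis]
    ring
  · congr 1
    field_simp

lemma tendsto_ellCoeff : Tendsto ellCoeff atTop (nhds 0) := by
  have h := tendsto_mul_ellCoeff.mul
    (tendsto_inv_atTop_zero.comp (tendsto_natCast_atTop_atTop (R := ℝ)))
  rw [mul_zero] at h
  refine h.congr' ?_
  filter_upwards [eventually_gt_atTop 0] with n hn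
  have : (0 : ℝ) < n := by exact_mod_cast hn
  simp only [Function.comp]
  field_simp

/-- The hypergeometric function `₂F₁(1/2, 1/2; 1; m)`. -/
noncomputable def ellK (m : ℝ) : ℝ := eulerSeries ellCoeff 0 m

/-- The function `m (1 - m) d/dm ₂F₁(1/2, 1/2; 1; m)`. -/
noncomputable def ellD (m : ℝ) : ℝ := (1 - m) * eulerSeries ellCoeff 1 m

lemma eulerSeries_ellCoeff_two {m : ℝ} (h0 : 0 ≤ m) (h1 : m < 1) :
    (1 - m) * eulerSeries ellCoeff 2 m =
      m * (eulerSeries ellCoeff 1 m + eulerSeries ellCoeff 0 m / 4) := by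
  have hs : ∀ k, Summable fun n : ℕ => (n : ℝ) ^ k * ellCoeff n * m ^ n := fun k =>
    summable_eulerSeries one_pos abs_ellCoeff_le k (by rwa [one_mul, abs_of_nonneg h0])
  have key : eulerSeries ellCoeff 2 m = m * (eulerSeries ellCoeff 2 m + eulerSeries ellCoeff 1 m
      + eulerSeries ellCoeff 0 m / 4) := by
    unfold eulerSeries
    rw [← (hs 2).tsum_add (hs 1), ← tsum_div_const,
      ← ((hs 2).add (hs 1)).tsum_add ((hs 0).div_const 4), ← tsum_mul_left,
      (hs 2).tsum_eq_zero_add]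
    simp only [Nat.cast_zero, ne_eq, OfNat.ofNat_ne_zero, not_false_eq_true, zero_pow, zero_mul,
      zero_add]
    refine tsum_congr fun n => ?_
    push_cast
    rw [succ_sq_mul_ellCoeff_succ]
    ring
  linear_combination key

lemma hasDerivAt_ellK {m : ℝ} (h0 : 0 < m) (h1 : m < 1) :
    HasDerivAt ellK (ellD m / (m * (1 - m))) m := by
  refine (hasDerivAt_eulerSeries one_pos abs_ellCoeff_le 0 h0 (by linarith)).congr_deriv ?_
  have : 1 - m ≠ 0 := by linarith
  rw [ellD]
  field_simp

lemma hasDerivAt_ellD {m : ℝ} (h0 : 0 < m) (h1 : m < 1) :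
    HasDerivAt ellD (ellK m / 4) m := by
  have h := ((hasDerivAt_id m).const_sub 1).mul
    (hasDerivAt_eulerSeries one_pos abs_ellCoeff_le 1 h0 (by linarith))
  refine h.congr_deriv ?_
  have := eulerSeries_ellCoeff_two h0.le h1
  simp only [id, ellK]
  field_simp
  linear_combination 4 * this

lemma ellK_zero : ellK 0 = 1 := by rw [ellK, eulerSeries_zero_left, ellCoeff_zero]

lemma ellD_zero : ellD 0 = 0 := by rw [ellD, eulerSeries_succ_zero, mul_zero]

lemma continuousOn_ellK {r : ℝ} (h0 : 0 ≤ r) (h1 : r < 1) : ContinuousOn ellK (Set.Icc 0 r) :=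
  continuousOn_eulerSeries one_pos abs_ellCoeff_le 0 h0 (by linarith)

lemma continuousOn_ellD {r : ℝ} (h0 : 0 ≤ r) (h1 : r < 1) : ContinuousOn ellD (Set.Icc 0 r) :=
  (continuousOn_const.sub continuousOn_id).mul
    (continuousOn_eulerSeries one_pos abs_ellCoeff_le 1 h0 (by linarith))

lemma ellK_pos {m : ℝ} (h0 : 0 ≤ m) (h1 : m < 1) : 0 < ellK m := by
  have hs := summable_eulerSeries one_pos abs_ellCoeff_le 0 (z := m)
    (by rwa [one_mul, abs_of_nonneg h0])
  refine hs.tsum_pos (fun n => ?_) 0 (by simp [ellCoeff_zero])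
  have := ellCoeff_nonneg n
  positivity

lemma abs_ellD_le {m : ℝ} (h0 : 0 ≤ m) (h1 : m ≤ 1 / 2) : |ellD m| ≤ 2 * m := by
  have hs := summable_eulerSeries one_pos abs_ellCoeff_le 1 (z := m)
    (by rw [one_mul, abs_of_nonneg h0]; linarith)
  have hnorm : ‖m‖ < 1 := by rw [Real.norm_eq_abs, abs_of_nonneg h0]; linarith
  have hle : eulerSeries ellCoeff 1 m ≤ m / (1 - m) ^ 2 := by
    rw [← tsum_coe_mul_geometric_of_norm_lt_one hnorm]
    refine hs.tsum_le_tsum (fun n => ?_)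
      (by simpa using summable_pow_mul_geometric_of_norm_lt_one 1 hnorm)
    have := ellCoeff_le_one n
    rw [pow_one]
    gcongr
    exact mul_le_of_le_one_right n.cast_nonneg this
  have hnn : 0 ≤ eulerSeries ellCoeff 1 m := tsum_nonneg fun n => by
    have := ellCoeff_nonneg n
    positivity
  have hm : 0 < 1 - m := by linarith
  rw [ellD, abs_of_nonneg (by positivity)]
  calc (1 - m) * eulerSeries ellCoeff 1 m ≤ (1 - m) * (m / (1 - m) ^ 2) := by gcongr
    _ = m / (1 - m) := by field_simp
    _ ≤ 2 * m := by rw [div_le_iff₀ hm]; nlinarith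

lemma tendsto_one_sub_mul_ellK :
    Tendsto (fun m => (1 - m) * ellK m) (nhdsWithin 1 (Set.Iio 1)) (nhds 0) := by
  simpa [ellK, eulerSeries] using tendsto_one_sub_mul_tsum tendsto_ellCoeff (C := 1)
    fun n => by simpa using abs_ellCoeff_le n

lemma tendsto_ellD : Tendsto ellD (nhdsWithin 1 (Set.Iio 1)) (nhds (1 / π)) := by
  obtain ⟨C, hC⟩ := (Metric.isBounded_range_of_tendsto _ tendsto_mul_ellCoeff).exists_norm_le
  have h := tendsto_one_sub_mul_tsum tendsto_mul_ellCoeff (C := C)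
    fun n => hC _ (Set.mem_range_self n)
  unfold ellD eulerSeries
  simpa only [pow_one] using h

/-- The coefficients of Appell's series `F₄(1/2, 1/2; 1, 1; X, Y)`. -/
noncomputable def appellCoeff (p : ℕ × ℕ) : ℝ :=
  ellCoeff (p.1 + p.2) * ((p.1 + p.2).choose p.1 : ℝ) ^ 2

lemma appellCoeff_nonneg (p : ℕ × ℕ) : 0 ≤ appellCoeff p :=
  mul_nonneg (ellCoeff_nonneg _) (sq_nonneg _)

lemma appellCoeff_le (p : ℕ × ℕ) : appellCoeff p ≤ 4 ^ p.1 * 4 ^ p.2 := by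
  have h : ((p.1 + p.2).choose p.1 : ℝ) ≤ 2 ^ (p.1 + p.2) := by
    exact_mod_cast Nat.choose_le_two_pow _ _
  calc appellCoeff p ≤ 1 * (2 ^ (p.1 + p.2)) ^ 2 := by
        unfold appellCoeff
        gcongr
        exact ellCoeff_le_one _
    _ = 4 ^ p.1 * 4 ^ p.2 := by
        rw [one_mul, ← pow_mul, mul_comm, pow_mul, pow_add]
        norm_num

lemma appellCoeff_succ_left (m n : ℕ) :
    ((m : ℝ) + 1) ^ 2 * appellCoeff (m + 1, n) =
      ((m : ℝ) + n + 1 / 2) ^ 2 * appellCoeff (m, n) := by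
  have h1 := succ_sq_mul_ellCoeff_succ (m + n)
  have h2 : ((m : ℝ) + n + 1) * ((m + n).choose m : ℝ) =
      ((m + n + 1).choose (m + 1) : ℝ) * (m + 1) := by
    exact_mod_cast Nat.add_one_mul_choose_eq (m + n) m
  unfold appellCoeff
  simp only [show m + 1 + n = m + n + 1 by ring]
  push_cast at h1
  calc ((m : ℝ) + 1) ^ 2 * (ellCoeff (m + n + 1) * ((m + n + 1).choose (m + 1) : ℝ) ^ 2)
      = ellCoeff (m + n + 1) * (((m + n + 1).choose (m + 1) : ℝ) * (m + 1)) ^ 2 := by ring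
    _ = (((m : ℝ) + n + 1) ^ 2 * ellCoeff (m + n + 1)) * ((m + n).choose m : ℝ) ^ 2 := by
        rw [← h2]; ring
    _ = _ := by rw [h1]; ring

lemma appellCoeff_swap (m n : ℕ) : appellCoeff (m, n) = appellCoeff (n, m) := by
  simp only [appellCoeff]
  rw [add_comm n m, Nat.choose_symm_add]

lemma appellCoeff_succ_right (m n : ℕ) :
    ((n : ℝ) + 1) ^ 2 * appellCoeff (m, n + 1) =
      ((m : ℝ) + n + 1 / 2) ^ 2 * appellCoeff (m, n) := by
  rw [appellCoeff_swap m (n + 1), appellCoeff_swap m n, appellCoeff_succ_left]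
  ring

/-- The series obtained from `F₄(1/2, 1/2; 1, 1; X, Y)` by applying `X ∂/∂X` `i` times and
`Y ∂/∂Y` `j` times. -/
noncomputable def appellSeries (i j : ℕ) (X Y : ℝ) : ℝ :=
  ∑' p : ℕ × ℕ, (p.1 : ℝ) ^ i * (p.2 : ℝ) ^ j * appellCoeff p * (X ^ p.1 * Y ^ p.2)

/-- A summable majorant for the terms of `appellSeries i j` on `[0, 1/8]²`. -/
noncomputable def appellBound (i j : ℕ) (p : ℕ × ℕ) : ℝ :=
  ((p.1 : ℝ) ^ i * (1 / 2) ^ p.1) * ((p.2 : ℝ) ^ j * (1 / 2) ^ p.2)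

lemma summable_appellBound (i j : ℕ) : Summable (appellBound i j) := by
  have h : ∀ k : ℕ, Summable fun n : ℕ => (n : ℝ) ^ k * (1 / 2 : ℝ) ^ n := fun k =>
    summable_pow_mul_geometric_of_norm_lt_one k (by norm_num)
  exact (h i).mul_of_nonneg (h j) (fun n => by positivity) (fun n => by positivity)

lemma norm_appellSeries_term_le (i j : ℕ) (p : ℕ × ℕ) {X Y : ℝ} (hX : X ∈ Set.Icc 0 (1 / 8))
    (hY : Y ∈ Set.Icc 0 (1 / 8)) :
    ‖(p.1 : ℝ) ^ i * (p.2 : ℝ) ^ j * appellCoeff p * (X ^ p.1 * Y ^ p.2)‖ ≤ appellBound i j p := by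
  have h0 := appellCoeff_nonneg p
  have h1 := hX.1
  have h2 := hY.1
  rw [Real.norm_of_nonneg (by positivity)]
  calc (p.1 : ℝ) ^ i * (p.2 : ℝ) ^ j * appellCoeff p * (X ^ p.1 * Y ^ p.2)
      ≤ (p.1 : ℝ) ^ i * (p.2 : ℝ) ^ j * (4 ^ p.1 * 4 ^ p.2) *
          ((1 / 8) ^ p.1 * (1 / 8) ^ p.2) := by
        gcongr
        · exact appellCoeff_le p
        · exact hX.2
        · exact hY.2
    _ = (p.1 : ℝ) ^ i * (p.2 : ℝ) ^ j * ((4 * (1 / 8)) ^ p.1 * (4 * (1 / 8)) ^ p.2) := by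
        rw [mul_pow, mul_pow]; ring
    _ = appellBound i j p := by
        unfold appellBound; norm_num; ring

lemma summable_appellSeries (i j : ℕ) {X Y : ℝ} (hX : X ∈ Set.Icc 0 (1 / 8))
    (hY : Y ∈ Set.Icc 0 (1 / 8)) : Summable fun p : ℕ × ℕ =>
      (p.1 : ℝ) ^ i * (p.2 : ℝ) ^ j * appellCoeff p * (X ^ p.1 * Y ^ p.2) :=
  Summable.of_norm_bounded (summable_appellBound i j)
    fun p => norm_appellSeries_term_le i j p hX hY

/-- The right-hand side of the partial differential equations for
`F₄(1/2, 1/2; 1, 1; X, Y)`. -/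
noncomputable def appellRhs (X Y : ℝ) : ℝ :=
  appellSeries 2 0 X Y + 2 * appellSeries 1 1 X Y + appellSeries 0 2 X Y +
    appellSeries 1 0 X Y + appellSeries 0 1 X Y + appellSeries 0 0 X Y / 4

lemma appellRhs_eq_tsum {X Y : ℝ} (hX : X ∈ Set.Icc 0 (1 / 8)) (hY : Y ∈ Set.Icc 0 (1 / 8)) :
    appellRhs X Y = ∑' p : ℕ × ℕ,
      ((p.1 : ℝ) + p.2 + 1 / 2) ^ 2 * appellCoeff p * (X ^ p.1 * Y ^ p.2) := by
  have hs := fun i j => (summable_appellSeries i j hX hY).hasSum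
  have h := (((((hs 2 0).add ((hs 1 1).mul_left 2)).add (hs 0 2)).add (hs 1 0)).add
    (hs 0 1)).add ((hs 0 0).div_const 4)
  refine h.tsum_eq.symm.trans (tsum_congr fun p => ?_)
  ring

lemma appellSeries_two_zero {X Y : ℝ} (hX : X ∈ Set.Icc 0 (1 / 8))
    (hY : Y ∈ Set.Icc 0 (1 / 8)) : appellSeries 2 0 X Y = X * appellRhs X Y := by
  have hinj : Function.Injective fun p : ℕ × ℕ => (p.1 + 1, p.2) := by
    rintro ⟨a, b⟩ ⟨c, d⟩ h
    simpa using h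
  rw [appellRhs_eq_tsum hX hY, ← tsum_mul_left, appellSeries, ← hinj.tsum_eq]
  · refine tsum_congr fun p => ?_
    push_cast
    rw [pow_zero, mul_one, appellCoeff_succ_left]
    ring
  · rintro ⟨a, b⟩ h
    rcases a with _ | a
    · simp at h
    · exact ⟨(a, b), rfl⟩

lemma appellSeries_zero_two {X Y : ℝ} (hX : X ∈ Set.Icc 0 (1 / 8))
    (hY : Y ∈ Set.Icc 0 (1 / 8)) : appellSeries 0 2 X Y = Y * appellRhs X Y := by
  have hinj : Function.Injective fun p : ℕ × ℕ => (p.1, p.2 + 1) := by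
    rintro ⟨a, b⟩ ⟨c, d⟩ h
    simpa using h
  rw [appellRhs_eq_tsum hX hY, ← tsum_mul_left, appellSeries, ← hinj.tsum_eq]
  · refine tsum_congr fun p => ?_
    push_cast
    rw [pow_zero, one_mul, appellCoeff_succ_right]
    ring
  · rintro ⟨a, b⟩ h
    rcases b with _ | b
    · simp at h
    · exact ⟨(a, b), rfl⟩

/-- `appellSeries i j` at `X = α (1 - β)`, `Y = β (1 - α)`. -/
noncomputable def baileySeries (i j : ℕ) (β α : ℝ) : ℝ :=
  appellSeries i j (α * (1 - β)) (β * (1 - α))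

lemma mul_one_sub_mem_Icc {a b : ℝ} (ha : a ∈ Set.Icc (0 : ℝ) (1 / 8))
    (hb : b ∈ Set.Icc (0 : ℝ) (1 / 8)) : a * (1 - b) ∈ Set.Icc (0 : ℝ) (1 / 8) := by
  obtain ⟨h1, h2⟩ := ha
  obtain ⟨h3, h4⟩ := hb
  exact ⟨mul_nonneg h1 (by linarith), by nlinarith⟩

lemma hasDerivAt_baileySeries (i j : ℕ) {α β : ℝ} (hα : α ∈ Set.Ioo (0 : ℝ) (1 / 8))
    (hβ : β ∈ Set.Icc (0 : ℝ) (1 / 8)) :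
    HasDerivAt (baileySeries i j β)
      (baileySeries (i + 1) j β α / α - baileySeries i (j + 1) β α / (1 - α)) α := by
  have hmem : ∀ y ∈ Set.Ioo (α / 2) (1 / 8),
      y * (1 - β) ∈ Set.Icc (0 : ℝ) (1 / 8) ∧ β * (1 - y) ∈ Set.Icc (0 : ℝ) (1 / 8) := by
    intro y hy
    have hy' : y ∈ Set.Icc (0 : ℝ) (1 / 8) := ⟨by linarith [hy.1, hα.1], hy.2.le⟩
    exact ⟨mul_one_sub_mem_Icc hy' hβ, mul_one_sub_mem_Icc hβ hy'⟩
  have hα' : α ∈ Set.Ioo (α / 2) (1 / 8) := ⟨by linarith [hα.1], hα.2⟩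
  have h0 := hα.1
  have hsum := ((summable_appellBound (i + 1) j).div_const (α / 2)).add
    ((summable_appellBound i (j + 1)).div_const (1 / 2))
  have := hasDerivAt_tsum_of_isPreconnected
    (u := fun p => appellBound (i + 1) j p / (α / 2) + appellBound i (j + 1) p / (1 / 2))
    (g := fun (p : ℕ × ℕ) (y : ℝ) => (p.1 : ℝ) ^ i * (p.2 : ℝ) ^ j * appellCoeff p *
      ((y * (1 - β)) ^ p.1 * (β * (1 - y)) ^ p.2))
    (g' := fun (p : ℕ × ℕ) (y : ℝ) =>
      (p.1 : ℝ) ^ (i + 1) * (p.2 : ℝ) ^ j * appellCoeff p *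
        ((y * (1 - β)) ^ p.1 * (β * (1 - y)) ^ p.2) / y -
      (p.1 : ℝ) ^ i * (p.2 : ℝ) ^ (j + 1) * appellCoeff p *
        ((y * (1 - β)) ^ p.1 * (β * (1 - y)) ^ p.2) / (1 - y))
    (t := Set.Ioo (α / 2) (1 / 8)) (y₀ := α) (y := α) hsum isOpen_Ioo isPreconnected_Ioo ?_ ?_
    hα' (summable_appellSeries i j (hmem α hα').1 (hmem α hα').2) hα'
  · rwa [((summable_appellSeries (i + 1) j (hmem α hα').1 (hmem α hα').2).div_const α).tsum_sub
      ((summable_appellSeries i (j + 1) (hmem α hα').1 (hmem α hα').2).div_const (1 - α)),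
      tsum_div_const, tsum_div_const] at this
  · rintro ⟨m, n⟩ y hy
    have hy0 : y ≠ 0 := by have := hy.1; intro h; linarith
    have hy1 : 1 - y ≠ 0 := by have := hy.2; intro h; linarith
    have h1 := ((hasDerivAt_id y).mul_const (1 - β)).pow m
    have h2 := (((hasDerivAt_id y).const_sub 1).const_mul β).pow n
    refine ((h1.mul h2).const_mul ((m : ℝ) ^ i * (n : ℝ) ^ j * appellCoeff (m, n))).congr_deriv ?_
    have e1 : (m : ℝ) * (y * (1 - β)) ^ (m - 1) * (1 - β) = m * (y * (1 - β)) ^ m / y := by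
      rcases m with _ | m
      · simp
      · rw [Nat.add_sub_cancel, pow_succ]
        field_simp
    have e2 : (n : ℝ) * (β * (1 - y)) ^ (n - 1) * β = n * (β * (1 - y)) ^ n / (1 - y) := by
      rcases n with _ | n
      · simp
      · rw [Nat.add_sub_cancel, pow_succ]
        field_simp
    simp only [id, Pi.pow_apply]
    linear_combination (m : ℝ) ^ i * (n : ℝ) ^ j * appellCoeff (m, n) *
      ((β * (1 - y)) ^ n * e1 - (y * (1 - β)) ^ m * e2)
  · intro p y hy
    have hy0 : 0 < y := by linarith [hy.1]
    have hy1 : 1 / 2 ≤ 1 - y := by linarith [hy.2]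
    have hy2 := hy.1.le
    obtain ⟨hX, hY⟩ := hmem y hy
    have h1 := norm_appellSeries_term_le (i + 1) j p hX hY
    have h2 := norm_appellSeries_term_le i (j + 1) p hX hY
    have h3 := (norm_nonneg _).trans h1
    have h4 := (norm_nonneg _).trans h2
    refine (norm_sub_le _ _).trans ?_
    rw [norm_div, norm_div _ (1 - y), Real.norm_of_nonneg hy0.le,
      Real.norm_of_nonneg (show 0 ≤ 1 - y by linarith)]
    gcongr

lemma continuousOn_baileySeries (i j : ℕ) {β : ℝ} (hβ : β ∈ Set.Icc (0 : ℝ) (1 / 8)) :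
    ContinuousOn (baileySeries i j β) (Set.Icc 0 (1 / 8)) :=
  continuousOn_tsum (fun p => by fun_prop) (summable_appellBound i j) fun p _ hx =>
    norm_appellSeries_term_le i j p (mul_one_sub_mem_Icc hx hβ) (mul_one_sub_mem_Icc hβ hx)

lemma baileySeries_zero (β : ℝ) : baileySeries 0 0 β 0 = ellK β := by
  have hinj : Function.Injective fun n : ℕ => ((0, n) : ℕ × ℕ) := fun a b h => by simpa using h
  rw [baileySeries, appellSeries, ← hinj.tsum_eq]
  · refine tsum_congr fun n => ?_
    simp [appellCoeff]
  · rintro ⟨a, b⟩ h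
    rcases a with _ | a
    · exact ⟨b, rfl⟩
    · simp at h

lemma baileySeries_one_zero (β : ℝ) : baileySeries 1 0 β 0 = 0 := by
  rw [baileySeries, appellSeries]
  refine (tsum_congr fun p => ?_).trans tsum_zero
  rcases p with ⟨_ | a, b⟩ <;> simp

/-- Bailey's factorisation of `F₄(1/2, 1/2; 1, 1; α(1 - β), β(1 - α))`. -/
lemma baileySeries_eq_mul {α β : ℝ} (hα : α ∈ Set.Ioo (0 : ℝ) (1 / 8))
    (hβ : β ∈ Set.Icc (0 : ℝ) (1 / 8)) :
    baileySeries 0 0 β α = ellK α * ellK β := by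
  let s : ℝ → ℝ := fun y => (1 - y) * baileySeries 1 0 β y - y * baileySeries 0 1 β y
  have hsub : ∀ {y}, y ∈ Set.Ioo (0 : ℝ) (1 / 8) → Set.Icc 0 y ⊆ Set.Icc (0 : ℝ) (1 / 8) :=
    fun hy => Set.Icc_subset_Icc le_rfl hy.2.le
  have hK := continuousOn_ellK (r := 1 / 8) (by norm_num) (by norm_num)
  have hD := continuousOn_ellD (r := 1 / 8) (by norm_num) (by norm_num)
  have hS := continuousOn_baileySeries 0 0 hβ
  have hs : ContinuousOn s (Set.Icc 0 (1 / 8)) :=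
    ((continuousOn_const.sub continuousOn_id).mul (continuousOn_baileySeries 1 0 hβ)).sub
      (continuousOn_id.mul (continuousOn_baileySeries 0 1 hβ))
  have dS : ∀ y ∈ Set.Ioo (0 : ℝ) (1 / 8),
      HasDerivAt (baileySeries 0 0 β) (s y / (y * (1 - y))) y := by
    intro y hy
    refine (hasDerivAt_baileySeries 0 0 hy hβ).congr_deriv ?_
    have := hy.1
    have : 1 - y ≠ 0 := by linarith [hy.2]
    simp only [s]
    field_simp
  have ds : ∀ y ∈ Set.Ioo (0 : ℝ) (1 / 8), HasDerivAt s (baileySeries 0 0 β y / 4) y := by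
    intro y hy
    refine ((((hasDerivAt_id y).const_sub 1).mul (hasDerivAt_baileySeries 1 0 hy hβ)).sub
      ((hasDerivAt_id y).mul (hasDerivAt_baileySeries 0 1 hy hβ))).congr_deriv ?_
    have hy0 := hy.1
    have hy1 : 1 - y ≠ 0 := by linarith [hy.2]
    have hy' : y ∈ Set.Icc (0 : ℝ) (1 / 8) := ⟨hy.1.le, hy.2.le⟩
    have h20 := appellSeries_two_zero (mul_one_sub_mem_Icc hy' hβ) (mul_one_sub_mem_Icc hβ hy')
    have h02 := appellSeries_zero_two (mul_one_sub_mem_Icc hy' hβ) (mul_one_sub_mem_Icc hβ hy')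
    have hM : appellRhs (y * (1 - β)) (β * (1 - y)) = baileySeries 2 0 β y +
      2 * baileySeries 1 1 β y + baileySeries 0 2 β y + baileySeries 1 0 β y +
      baileySeries 0 1 β y + baileySeries 0 0 β y / 4 := rfl
    change baileySeries 2 0 β y = _ at h20
    change baileySeries 0 2 β y = _ at h02
    set M := appellRhs (y * (1 - β)) (β * (1 - y))
    have hd20 : baileySeries 2 0 β y / y = (1 - β) * M := by rw [h20]; field_simp
    have hd02 : baileySeries 0 2 β y / (1 - y) = β * M := by rw [h02]; field_simp
    simp only [id, zero_add, one_add_one_eq_two]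
    have e1 : (1 - y) * (baileySeries 1 1 β y / (1 - y)) = baileySeries 1 1 β y := by field_simp
    have e2 : y * (baileySeries 1 1 β y / y) = baileySeries 1 1 β y := by field_simp
    linear_combination (1 - y) * hd20 + y * hd02 - e1 - e2 + hM + h20 + h02
  have wzero : ∀ y ∈ Set.Ioo (0 : ℝ) (1 / 8),
      baileySeries 0 0 β y * ellD y - s y * ellK y = 0 := by
    intro y hy
    have h := eq_of_hasDerivAt_zero
      (f := fun y => baileySeries 0 0 β y * ellD y - s y * ellK y) hy.1
      (((hS.mul hD).sub (hs.mul hK)).mono (hsub hy)) ?_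
    · simpa [s, ellD_zero, baileySeries_one_zero] using h
    · intro x hx
      have hx' : x ∈ Set.Ioo (0 : ℝ) (1 / 8) := ⟨hx.1, hx.2.trans hy.2⟩
      have hx1 : x < 1 := by linarith [hx'.2]
      refine (((dS x hx').mul (hasDerivAt_ellD hx.1 hx1)).sub
        ((ds x hx').mul (hasDerivAt_ellK hx.1 hx1))).congr_deriv ?_
      ring
  have h := eq_of_hasDerivAt_zero (f := fun y => baileySeries 0 0 β y / ellK y) hα.1
    ((hS.mono (hsub hα)).div (hK.mono (hsub hα))
      fun x hx => (ellK_pos hx.1 (by linarith [hx.2, hα.2])).ne') ?_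
  · simp only [baileySeries_zero, ellK_zero, div_one] at h
    rw [div_eq_iff (ellK_pos hα.1.le (by linarith [hα.2])).ne'] at h
    rw [h, mul_comm]
  · intro x hx
    have hx' : x ∈ Set.Ioo (0 : ℝ) (1 / 8) := ⟨hx.1, hx.2.trans hα.2⟩
    have hx1 : x < 1 := by linarith [hx'.2]
    have hpos := (ellK_pos hx.1.le hx1).ne'
    refine ((dS x hx').div (hasDerivAt_ellK hx.1 hx1) hpos).congr_deriv ?_
    rw [div_eq_zero_iff]
    left
    linear_combination -wzero x hx' / (x * (1 - x))

/-- The coefficients `C(2n,n)² Pₙ(19/13) / 16ⁿ`. -/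
noncomputable def brafmanCoeff (n : ℕ) : ℝ := ellCoeff n * legendreP n (19 / 13)

lemma legendreP_mul_pow (n : ℕ) (x z : ℝ) :
    legendreP n x * z ^ n = ∑ p ∈ Finset.HasAntidiagonal.antidiagonal n,
      ((p.1 + p.2).choose p.1 : ℝ) ^ 2 * (((x - 1) / 2 * z) ^ p.1 * ((x + 1) / 2 * z) ^ p.2) := by
  rw [← Finset.Nat.sum_antidiagonal_swap, Finset.Nat.sum_antidiagonal_eq_sum_range_succ_mk,
    legendreP, Finset.mul_sum, Finset.sum_mul]
  refine Finset.sum_congr rfl fun j hj => ?_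
  have hj' : j ≤ n := Nat.lt_succ_iff.1 (Finset.mem_range.1 hj)
  have h2 : (2 : ℝ)⁻¹ ^ n * z ^ n = (2⁻¹ * z) ^ (n - j) * (2⁻¹ * z) ^ j := by
    rw [← pow_add, Nat.sub_add_cancel hj', mul_pow]
  simp only [Prod.swap, Nat.sub_add_cancel hj', Nat.choose_symm hj']
  rw [div_eq_mul_inv, div_eq_mul_inv, mul_assoc (x - 1), mul_assoc (x + 1), mul_pow (x - 1),
    mul_pow (x + 1)]
  linear_combination (n.choose j : ℝ) ^ 2 * (x - 1) ^ (n - j) * (x + 1) ^ j * h2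

lemma abs_legendreP_le {x : ℝ} (hx : 1 ≤ x) (n : ℕ) : |legendreP n x| ≤ (2 * x) ^ n := by
  have h1 : 0 ≤ x - 1 := by linarith
  have h2 : 0 ≤ x + 1 := by linarith
  rw [abs_of_nonneg (by unfold legendreP; positivity), legendreP]
  calc (2 : ℝ)⁻¹ ^ n * ∑ j ∈ Finset.range (n + 1),
          (n.choose j : ℝ) ^ 2 * (x - 1) ^ (n - j) * (x + 1) ^ j
      ≤ (2 : ℝ)⁻¹ ^ n * ∑ j ∈ Finset.range (n + 1),
          2 ^ n * ((x + 1) ^ j * (x - 1) ^ (n - j) * (n.choose j : ℝ)) := by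
        refine mul_le_mul_of_nonneg_left (Finset.sum_le_sum fun j _ => ?_) (by positivity)
        have : (n.choose j : ℝ) ≤ 2 ^ n := by exact_mod_cast Nat.choose_le_two_pow n j
        calc (n.choose j : ℝ) ^ 2 * (x - 1) ^ (n - j) * (x + 1) ^ j
            = (n.choose j : ℝ) * ((x + 1) ^ j * (x - 1) ^ (n - j) * (n.choose j : ℝ)) := by ring
          _ ≤ _ := by gcongr
    _ = (2 * x) ^ n := by
        rw [← Finset.mul_sum, ← add_pow, ← mul_assoc, ← mul_pow]
        norm_num
        ring

lemma abs_brafmanCoeff_le (n : ℕ) : |brafmanCoeff n| ≤ 3 ^ n := by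
  rw [brafmanCoeff, abs_mul]
  have h1 := abs_ellCoeff_le n
  have h2 := abs_legendreP_le (x := 19 / 13) (by norm_num) n
  calc |ellCoeff n| * |legendreP n (19 / 13)| ≤ 1 ^ n * (2 * (19 / 13)) ^ n := by gcongr
    _ ≤ 1 ^ n * 3 ^ n := by gcongr; norm_num
    _ = 3 ^ n := by rw [one_pow, one_mul]

lemma eulerSeries_brafmanCoeff {z : ℝ} (hz : z ∈ Set.Ioo (0 : ℝ) (1 / 16)) :
    eulerSeries brafmanCoeff 0 z = appellSeries 0 0 (3 / 13 * z) (16 / 13 * z) := by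
  obtain ⟨h0, h1⟩ := hz
  have hs := summable_appellSeries 0 0 (X := 3 / 13 * z) (Y := 16 / 13 * z)
    ⟨by linarith, by linarith⟩ ⟨by linarith, by linarith⟩
  let e := Finset.HasAntidiagonal.sigmaAntidiagonalEquivProd (A := ℕ)
  refine Eq.trans ?_ ((e.summable_iff.2 hs).tsum_sigma.symm.trans (e.tsum_eq fun p : ℕ × ℕ =>
    (p.1 : ℝ) ^ 0 * (p.2 : ℝ) ^ 0 * appellCoeff p * ((3 / 13 * z) ^ p.1 * (16 / 13 * z) ^ p.2)))
  refine tsum_congr fun n => ?_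
  rw [tsum_fintype, Finset.univ_eq_attach, pow_zero, one_mul, brafmanCoeff, mul_assoc,
    legendreP_mul_pow, Finset.mul_sum, ← Finset.sum_attach]
  refine Finset.sum_congr rfl fun p _ => ?_
  have hp := Finset.HasAntidiagonal.mem_antidiagonal.1 p.2
  simp only [Function.comp, e, Finset.HasAntidiagonal.sigmaAntidiagonalEquivProd_apply, appellCoeff, hp]
  norm_num
  ring

lemma eulerSeries_succ_of_hasDerivAt {g : ℕ → ℝ} {K : ℝ} (hK : 0 < K) (hg : ∀ n, |g n| ≤ K ^ n)
    {k : ℕ} {s : Set ℝ} (hs : IsOpen s) {h : ℝ → ℝ} (hgh : ∀ z ∈ s, eulerSeries g k z = h z)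
    {z h' : ℝ} (hz : z ∈ s) (hz0 : 0 < z) (hz1 : K * z < 1) (hh : HasDerivAt h (h' / z) z) :
    eulerSeries g (k + 1) z = h' := by
  have h1 := hasDerivAt_eulerSeries hK hg k hz0 hz1
  have h2 : eulerSeries g k =ᶠ[nhds z] h := by
    filter_upwards [hs.mem_nhds hz] with y hy using hgh y hy
  have h3 := h1.unique (hh.congr_of_eventuallyEq h2)
  field_simp at h3
  exact h3

/-- The square root `(1 - 2xz + z²)^(1/2)` at `x = 19/13`. -/
noncomputable def brafmanRho (z : ℝ) : ℝ := √(1 - 38 / 13 * z + z ^ 2)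

lemma brafmanRho_sq {z : ℝ} (hz : z ∈ Set.Ioo (0 : ℝ) (1 / 16)) :
    brafmanRho z ^ 2 = 1 - 38 / 13 * z + z ^ 2 :=
  Real.sq_sqrt (by nlinarith [hz.1, hz.2])

lemma brafmanRho_mem {z : ℝ} (hz : z ∈ Set.Ioo (0 : ℝ) (1 / 16)) :
    brafmanRho z ∈ Set.Ioo (3 / 4 + z) (1 - z) := by
  obtain ⟨h0, h1⟩ := hz
  constructor
  · exact Real.lt_sqrt_of_sq_lt (by nlinarith)
  · rw [brafmanRho, Real.sqrt_lt' (by linarith)]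
    nlinarith

/-- The first parameter of Brafman's formula at `x = 19/13`. -/
noncomputable def brafmanAlpha (z : ℝ) : ℝ := (1 - brafmanRho z - z) / 2

/-- The second parameter of Brafman's formula at `x = 19/13`. -/
noncomputable def brafmanBeta (z : ℝ) : ℝ := (1 - brafmanRho z + z) / 2

lemma brafmanAlpha_mem {z : ℝ} (hz : z ∈ Set.Ioo (0 : ℝ) (1 / 16)) :
    brafmanAlpha z ∈ Set.Ioo (0 : ℝ) (1 / 8) := by
  have h := brafmanRho_mem hz
  unfold brafmanAlpha
  exact ⟨by linarith [h.2], by linarith [h.1, hz.1]⟩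

lemma brafmanBeta_mem {z : ℝ} (hz : z ∈ Set.Ioo (0 : ℝ) (1 / 16)) :
    brafmanBeta z ∈ Set.Ioo (0 : ℝ) (1 / 8) := by
  have h := brafmanRho_mem hz
  unfold brafmanBeta
  exact ⟨by linarith [h.2, hz.1], by linarith [h.1]⟩

/-- Brafman's formula at `x = 19/13`. -/
lemma brafman {z : ℝ} (hz : z ∈ Set.Ioo (0 : ℝ) (1 / 16)) :
    eulerSeries brafmanCoeff 0 z = ellK (brafmanAlpha z) * ellK (brafmanBeta z) := by
  have hβ := brafmanBeta_mem hz
  rw [← baileySeries_eq_mul (brafmanAlpha_mem hz) ⟨hβ.1.le, hβ.2.le⟩,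
    eulerSeries_brafmanCoeff hz, baileySeries]
  have h := brafmanRho_sq hz
  congr 1
  · unfold brafmanAlpha brafmanBeta
    linear_combination h / 4
  · unfold brafmanAlpha brafmanBeta
    linear_combination h / 4

lemma hasDerivAt_brafmanRho {z : ℝ} (hz : z ∈ Set.Ioo (0 : ℝ) (1 / 16)) :
    HasDerivAt brafmanRho ((z - 19 / 13) / brafmanRho z) z := by
  have h := (((hasDerivAt_id z).const_mul (38 / 13)).const_sub 1).add (hasDerivAt_pow 2 z)
  have hne : 1 - 38 / 13 * z + z ^ 2 ≠ 0 := by nlinarith [hz.1, hz.2]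
  refine (h.sqrt hne).congr_deriv ?_
  have : brafmanRho z ≠ 0 := by linarith [(brafmanRho_mem hz).1, hz.1]
  change _ / (2 * brafmanRho z) = _
  field_simp
  norm_num
  ring

lemma hasDerivAt_brafmanAlpha {z : ℝ} (hz : z ∈ Set.Ioo (0 : ℝ) (1 / 16)) :
    HasDerivAt brafmanAlpha
      (brafmanAlpha z * (1 - brafmanAlpha z) / (brafmanRho z * z)) z := by
  refine ((((hasDerivAt_brafmanRho hz).const_sub 1).sub (hasDerivAt_id z)).div_const 2).congr_deriv
    ?_
  have h1 : brafmanRho z ≠ 0 := by linarith [(brafmanRho_mem hz).1, hz.1]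
  have h2 := hz.1
  have h3 := brafmanRho_sq hz
  unfold brafmanAlpha
  field_simp
  linear_combination 13 * h3

lemma hasDerivAt_brafmanBeta {z : ℝ} (hz : z ∈ Set.Ioo (0 : ℝ) (1 / 16)) :
    HasDerivAt brafmanBeta
      (brafmanBeta z * (1 - brafmanBeta z) / (brafmanRho z * z)) z := by
  refine ((((hasDerivAt_brafmanRho hz).const_sub 1).add (hasDerivAt_id z)).div_const 2).congr_deriv
    ?_
  have h1 : brafmanRho z ≠ 0 := by linarith [(brafmanRho_mem hz).1, hz.1]
  have h2 := hz.1
  have h3 := brafmanRho_sq hz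
  unfold brafmanBeta
  field_simp
  linear_combination 13 * h3

/-- The bilinear expression in `ellK` and `ellD` at the parameters `t⁴` and `((1 - t)/(1 + t))⁴`
which Legendre's relation asserts to be constant. -/
noncomputable def legendreForm (t : ℝ) : ℝ :=
  (1 + t) ^ 2 * (ellK (t ^ 4) * ellD (((1 - t) / (1 + t)) ^ 4)) +
    4 / (1 + t) ^ 2 * (ellD (t ^ 4) * ellK (((1 - t) / (1 + t)) ^ 4)) +
    2 * t * (1 - t) * (1 + t ^ 2) / (1 + t) ^ 2 *
      (ellK (t ^ 4) * ellK (((1 - t) / (1 + t)) ^ 4))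

lemma landen_mem {t : ℝ} (ht : t ∈ Set.Ioo (0 : ℝ) 1) :
    (1 - t) / (1 + t) ∈ Set.Ioo (0 : ℝ) 1 := by
  obtain ⟨h0, h1⟩ := ht
  exact ⟨div_pos (by linarith) (by linarith), by rw [div_lt_one (by linarith)]; linarith⟩

lemma pow_four_mem {t : ℝ} (ht : t ∈ Set.Ioo (0 : ℝ) 1) : t ^ 4 ∈ Set.Ioo (0 : ℝ) 1 :=
  ⟨pow_pos ht.1 4, pow_lt_one₀ ht.1.le ht.2 (by norm_num)⟩

lemma one_sub_landen_pow_four {t : ℝ} (ht : 0 < t) :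
    1 - ((1 - t) / (1 + t)) ^ 4 = 8 * t * (1 + t ^ 2) / (1 + t) ^ 4 := by
  field_simp
  ring

lemma hasDerivAt_legendreForm {t : ℝ} (ht : t ∈ Set.Ioo (0 : ℝ) 1) :
    HasDerivAt legendreForm 0 t := by
  have ha := pow_four_mem ht
  have hb := pow_four_mem (landen_mem ht)
  obtain ⟨h0, h1⟩ := ht
  have h1t : 1 - t ≠ 0 := by linarith
  have h2t : 1 + t ≠ 0 := by linarith
  have h3t : 1 + t ^ 2 ≠ 0 := by positivity
  have da : HasDerivAt (fun t : ℝ => t ^ 4) (4 * t ^ 3) t := by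
    simpa using hasDerivAt_pow 4 t
  have db : HasDerivAt (fun t : ℝ => ((1 - t) / (1 + t)) ^ 4)
      (-8 * (1 - t) ^ 3 / (1 + t) ^ 5) t := by
    refine ((((hasDerivAt_id t).const_sub 1).div ((hasDerivAt_id t).const_add 1) h2t).pow
      4).congr_deriv ?_
    simp only [id, Pi.div_apply]
    norm_num
    field_simp
    ring
  have dA : HasDerivAt (fun t => ellK (t ^ 4))
      (4 * ellD (t ^ 4) / (t * ((1 - t) * (1 + t) * (1 + t ^ 2)))) t := by
    refine (HasDerivAt.comp (h := fun t : ℝ => t ^ 4) t (hasDerivAt_ellK ha.1 ha.2) da).congr_deriv ?_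
    rw [show (1 - t ^ 4) = (1 - t) * (1 + t) * (1 + t ^ 2) by ring]
    field_simp
  have dα : HasDerivAt (fun t => ellD (t ^ 4)) (t ^ 3 * ellK (t ^ 4)) t := by
    refine (HasDerivAt.comp (h := fun t : ℝ => t ^ 4) t (hasDerivAt_ellD ha.1 ha.2) da).congr_deriv ?_
    ring
  have dB : HasDerivAt (fun t => ellK (((1 - t) / (1 + t)) ^ 4))
      (-ellD (((1 - t) / (1 + t)) ^ 4) * (1 + t) ^ 3 / (t * (1 - t) * (1 + t ^ 2))) t := by
    refine (HasDerivAt.comp t (hasDerivAt_ellK hb.1 hb.2) db).congr_deriv ?_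
    rw [one_sub_landen_pow_four h0]
    generalize ellD _ = b
    field_simp
  have dβ : HasDerivAt (fun t => ellD (((1 - t) / (1 + t)) ^ 4))
      (-2 * (1 - t) ^ 3 / (1 + t) ^ 5 * ellK (((1 - t) / (1 + t)) ^ 4)) t := by
    refine (HasDerivAt.comp t (hasDerivAt_ellD hb.1 hb.2) db).congr_deriv ?_
    ring
  have dp : HasDerivAt (fun t : ℝ => (1 + t) ^ 2) (2 * (1 + t)) t := by
    refine (((hasDerivAt_id t).const_add 1).pow 2).congr_deriv ?_
    simp
  have hp : (1 + t) ^ 2 ≠ 0 := pow_ne_zero _ h2t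
  have dq : HasDerivAt (fun t : ℝ => 4 / (1 + t) ^ 2) (-8 / (1 + t) ^ 3) t := by
    refine ((hasDerivAt_const t (4 : ℝ)).div dp hp).congr_deriv ?_
    field_simp
    ring
  have dr : HasDerivAt (fun t : ℝ => 2 * t * (1 - t) * (1 + t ^ 2) / (1 + t) ^ 2)
      (((2 * (1 - t) - 2 * t) * (1 + t ^ 2) + 4 * t ^ 2 * (1 - t)) / (1 + t) ^ 2 -
        4 * t * (1 - t) * (1 + t ^ 2) / (1 + t) ^ 3) t := by
    refine ((((((hasDerivAt_id t).const_mul 2).mul ((hasDerivAt_id t).const_sub 1)).mul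
      ((hasDerivAt_pow 2 t).const_add 1))).div dp hp).congr_deriv ?_
    simp only [id, Pi.mul_apply]
    norm_num
    field_simp
    ring
  refine (((dp.mul (dA.mul dβ)).add (dq.mul (dα.mul dB))).add
    (dr.mul (dA.mul dB))).congr_deriv ?_
  simp only [Pi.mul_apply]
  generalize ellD (t ^ 4) = a
  generalize ellD (((1 - t) / (1 + t)) ^ 4) = b
  generalize ellK (t ^ 4) = A
  generalize ellK (((1 - t) / (1 + t)) ^ 4) = B
  field_simp
  ring

lemma tendsto_legendreForm : Tendsto legendreForm (nhdsWithin 0 (Set.Ioi 0)) (nhds (1 / π)) := by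
  have hev : ∀ᶠ t : ℝ in nhdsWithin 0 (Set.Ioi 0), t ∈ Set.Ioo (0 : ℝ) (1 / 2) :=
    Ioo_mem_nhdsGT (by norm_num)
  have hlim : ∀ {f : ℝ → ℝ} {c : ℝ}, ContinuousAt f 0 → f 0 = c →
      Tendsto f (nhdsWithin 0 (Set.Ioi 0)) (nhds c) := fun hf hc =>
    hc ▸ hf.tendsto.mono_left nhdsWithin_le_nhds
  have hb : Tendsto (fun t : ℝ => ((1 - t) / (1 + t)) ^ 4) (nhdsWithin 0 (Set.Ioi 0))
      (nhdsWithin 1 (Set.Iio 1)) := by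
    refine tendsto_nhdsWithin_iff.2 ⟨hlim ?_ (by norm_num), ?_⟩
    · exact ((continuousAt_const.sub continuousAt_id).div
        (continuousAt_const.add continuousAt_id) (by norm_num)).pow 4
    · filter_upwards [hev] with t ht
      exact (pow_four_mem (landen_mem ⟨ht.1, ht.2.trans (by norm_num)⟩)).2
  have hA : Tendsto (fun t : ℝ => ellK (t ^ 4)) (nhdsWithin 0 (Set.Ioi 0)) (nhds 1) := by
    have h := (continuousOn_ellK (r := 1 / 2) (by norm_num) (by norm_num)) 0 (by norm_num)
    have h' : Tendsto (fun t : ℝ => t ^ 4) (nhdsWithin 0 (Set.Ioi 0))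
        (nhdsWithin 0 (Set.Icc 0 (1 / 2))) := by
      refine tendsto_nhdsWithin_iff.2 ⟨hlim (by fun_prop) (by norm_num), ?_⟩
      filter_upwards [hev] with t ht
      refine ⟨pow_nonneg ht.1.le 4, ?_⟩
      calc t ^ 4 ≤ (1 / 2) ^ 4 := pow_le_pow_left₀ ht.1.le ht.2.le 4
        _ ≤ 1 / 2 := by norm_num
    rw [← ellK_zero]
    exact h.tendsto.comp h'
  have hβ := tendsto_ellD.comp hb
  have hB : Tendsto (fun t : ℝ => t * ellK (((1 - t) / (1 + t)) ^ 4))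
      (nhdsWithin 0 (Set.Ioi 0)) (nhds 0) := by
    have h1 : Tendsto (fun t : ℝ => (1 + t) ^ 4 / (8 * (1 + t ^ 2))) (nhdsWithin 0 (Set.Ioi 0))
        (nhds (1 / 8)) := by
      refine hlim (ContinuousAt.div (by fun_prop) (by fun_prop) (by norm_num)) (by norm_num)
    have h2 := h1.mul (tendsto_one_sub_mul_ellK.comp hb)
    rw [mul_zero] at h2
    refine h2.congr' ?_
    filter_upwards [hev] with t ht
    have h0 := ht.1
    simp only [Function.comp]
    rw [one_sub_landen_pow_four h0]
    generalize ellK _ = B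
    field_simp
  have hα : Tendsto (fun t : ℝ => ellD (t ^ 4) / t) (nhdsWithin 0 (Set.Ioi 0)) (nhds 0) := by
    refine squeeze_zero_norm' (a := fun t : ℝ => 2 * t ^ 3) ?_ (hlim (by fun_prop) (by norm_num))
    filter_upwards [hev] with t ht
    have h0 := ht.1
    have h4 : t ^ 4 ≤ 1 / 2 := by
      calc t ^ 4 ≤ (1 / 2) ^ 4 := pow_le_pow_left₀ ht.1.le ht.2.le 4
        _ ≤ 1 / 2 := by norm_num
    rw [norm_div, Real.norm_eq_abs, Real.norm_of_nonneg h0.le, div_le_iff₀ h0]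
    refine (abs_ellD_le (by positivity) h4).trans_eq ?_
    ring
  have c1 : Tendsto (fun t : ℝ => (1 + t) ^ 2) (nhdsWithin 0 (Set.Ioi 0)) (nhds 1) :=
    hlim (by fun_prop) (by norm_num)
  have c2 : Tendsto (fun t : ℝ => 4 / (1 + t) ^ 2) (nhdsWithin 0 (Set.Ioi 0)) (nhds 4) :=
    hlim (ContinuousAt.div (by fun_prop) (by fun_prop) (by norm_num)) (by norm_num)
  have c3 : Tendsto (fun t : ℝ => 2 * (1 - t) * (1 + t ^ 2) / (1 + t) ^ 2)
      (nhdsWithin 0 (Set.Ioi 0)) (nhds 2) :=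
    hlim (ContinuousAt.div (by fun_prop) (by fun_prop) (by norm_num)) (by norm_num)
  have h := ((c1.mul (hA.mul hβ)).add (c2.mul (hα.mul hB))).add (c3.mul (hA.mul hB))
  simp only [mul_zero, add_zero, one_mul] at h
  refine h.congr' ?_
  filter_upwards [hev] with t ht
  have h0 := ht.1.ne'
  simp only [legendreForm, Function.comp]
  generalize ellD (((1 - t) / (1 + t)) ^ 4) = b
  generalize ellK (((1 - t) / (1 + t)) ^ 4) = B
  field_simp

/-- Legendre's relation. -/
lemma legendreForm_eq {t : ℝ} (ht : t ∈ Set.Ioo (0 : ℝ) 1) : legendreForm t = 1 / π := by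
  refine tendsto_nhds_unique (tendsto_const_nhds.congr' ?_) tendsto_legendreForm
  have hev : ∀ᶠ s : ℝ in nhdsWithin 0 (Set.Ioi 0), s ∈ Set.Ioo (0 : ℝ) t := Ioo_mem_nhdsGT ht.1
  filter_upwards [hev] with s hs
  exact eq_of_hasDerivAt_zero hs.2
    (fun x hx => (hasDerivAt_legendreForm
      ⟨hs.1.trans_le hx.1, hx.2.trans_lt ht.2⟩).continuousAt.continuousWithinAt)
    fun x hx => hasDerivAt_legendreForm ⟨hs.1.trans hx.1, hx.2.trans ht.2⟩

theorem stmt3 :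
    Tendsto (fun N => ∑ n ∈ Finset.range N,
      ((2 * n).choose n : ℝ) ^ 2 * legendreP n (19 / 13) * (65 / 20736) ^ n *
        (97756868 * (n : ℝ) ^ 3 - 24254580 * (n : ℝ) ^ 2 - 539415 * (n : ℝ) - 264590))
      atTop (nhds (6065280 / π)) := by
  let A : ℝ → ℝ := fun z => ellK (brafmanAlpha z)
  let a : ℝ → ℝ := fun z => ellD (brafmanAlpha z)
  let B : ℝ → ℝ := fun z => ellK (brafmanBeta z)
  let b : ℝ → ℝ := fun z => ellD (brafmanBeta z)
  let p : ℝ → ℝ := fun z => brafmanAlpha z * (1 - brafmanAlpha z)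
  let q : ℝ → ℝ := fun z => brafmanBeta z * (1 - brafmanBeta z)
  let τ : ℝ → ℝ := fun z => (1 - 2 * brafmanAlpha z) * p z + (1 - 2 * brafmanBeta z) * q z
  let r : ℝ → ℝ := brafmanRho
  have hr : ∀ z ∈ Set.Ioo (0 : ℝ) (1 / 16), r z ≠ 0 := fun z hz => by
    have := (brafmanRho_mem hz).1
    have := hz.1
    change brafmanRho z ≠ 0
    linarith
  have hp : ∀ z ∈ Set.Ioo (0 : ℝ) (1 / 16), p z ≠ 0 := fun z hz => by
    have := brafmanAlpha_mem hz
    exact mul_ne_zero this.1.ne' (by linarith [this.2])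
  have hq : ∀ z ∈ Set.Ioo (0 : ℝ) (1 / 16), q z ≠ 0 := fun z hz => by
    have := brafmanBeta_mem hz
    exact mul_ne_zero this.1.ne' (by linarith [this.2])
  have dA : ∀ z ∈ Set.Ioo (0 : ℝ) (1 / 16), HasDerivAt A (a z / (r z * z)) z := fun z hz => by
    have hm := brafmanAlpha_mem hz
    refine (HasDerivAt.comp z (hasDerivAt_ellK hm.1 (by linarith [hm.2]))
      (hasDerivAt_brafmanAlpha hz)).congr_deriv ?_
    change a z / p z * (p z / (r z * z)) = _
    have := hp z hz
    field_simp
  have dB : ∀ z ∈ Set.Ioo (0 : ℝ) (1 / 16), HasDerivAt B (b z / (r z * z)) z := fun z hz => by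
    have hm := brafmanBeta_mem hz
    refine (HasDerivAt.comp z (hasDerivAt_ellK hm.1 (by linarith [hm.2]))
      (hasDerivAt_brafmanBeta hz)).congr_deriv ?_
    change b z / q z * (q z / (r z * z)) = _
    have := hq z hz
    field_simp
  have da : ∀ z ∈ Set.Ioo (0 : ℝ) (1 / 16), HasDerivAt a (A z / 4 * (p z / (r z * z))) z :=
    fun z hz => by
      have hm := brafmanAlpha_mem hz
      exact HasDerivAt.comp z (hasDerivAt_ellD hm.1 (by linarith [hm.2]))
        (hasDerivAt_brafmanAlpha hz)
  have db : ∀ z ∈ Set.Ioo (0 : ℝ) (1 / 16), HasDerivAt b (B z / 4 * (q z / (r z * z))) z :=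
    fun z hz => by
      have hm := brafmanBeta_mem hz
      exact HasDerivAt.comp z (hasDerivAt_ellD hm.1 (by linarith [hm.2]))
        (hasDerivAt_brafmanBeta hz)
  have dσ : ∀ z ∈ Set.Ioo (0 : ℝ) (1 / 16),
      HasDerivAt (fun z => p z + q z) (τ z / (r z * z)) z := fun z hz => by
    have h1 := hasDerivAt_brafmanAlpha hz
    have h2 := hasDerivAt_brafmanBeta hz
    refine ((h1.mul (h1.const_sub 1)).add (h2.mul (h2.const_sub 1))).congr_deriv ?_
    simp only [τ, p, q, r]
    ring
  have dr : ∀ z ∈ Set.Ioo (0 : ℝ) (1 / 16),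
      HasDerivAt r (-(p z + q z) / (r z * z)) z := fun z hz => by
    have h1 := hasDerivAt_brafmanAlpha hz
    have h2 := hasDerivAt_brafmanBeta hz
    have he : r = fun z => 1 - brafmanAlpha z - brafmanBeta z := by
      ext z
      simp only [r, brafmanAlpha, brafmanBeta]
      ring
    rw [he]
    refine ((h1.const_sub 1).sub h2).congr_deriv ?_
    simp only [p, q]
    rw [← congrFun he z]
    ring
  have h3 : (0 : ℝ) < 3 := by norm_num
  have step := fun {k : ℕ} {h : ℝ → ℝ} =>
    eulerSeries_succ_of_hasDerivAt (k := k) (h := h) h3 abs_brafmanCoeff_le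
      (isOpen_Ioo (a := (0 : ℝ)) (b := 1 / 16))
  have G0 : ∀ z ∈ Set.Ioo (0 : ℝ) (1 / 16), eulerSeries brafmanCoeff 0 z = A z * B z :=
    fun z hz => brafman hz
  have G1 : ∀ z ∈ Set.Ioo (0 : ℝ) (1 / 16), eulerSeries brafmanCoeff 1 z =
      (a z * B z + A z * b z) / r z := fun z hz => by
    refine step G0 hz hz.1 (by linarith [hz.2])
      (((dA z hz).mul (dB z hz)).congr_deriv ?_)
    have := hr z hz
    have := hz.1
    field_simp
  have G2 : ∀ z ∈ Set.Ioo (0 : ℝ) (1 / 16), eulerSeries brafmanCoeff 2 z =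
      ((p z + q z) * (A z * B z) / 4 + 2 * (a z * b z)) / r z ^ 2 +
        (a z * B z + A z * b z) * (p z + q z) / r z ^ 3 := fun z hz => by
    refine step G1 hz hz.1 (by linarith [hz.2])
      (((((da z hz).mul (dB z hz)).add ((dA z hz).mul (db z hz))).div
        (dr z hz) (hr z hz)).congr_deriv ?_)
    have := hr z hz
    have := hz.1
    simp only [Pi.mul_apply, Pi.add_apply]
    field_simp
    ring
  have G3 : ∀ z ∈ Set.Ioo (0 : ℝ) (1 / 16), eulerSeries brafmanCoeff 3 z =
      (τ z * (A z * B z) / 4 + (p z + q z) * (a z * B z + A z * b z) / 4 +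
          (p z * (A z * b z) + q z * (a z * B z)) / 2) / r z ^ 3 +
        (3 * (p z + q z) * ((p z + q z) * (A z * B z) / 4 + 2 * (a z * b z)) +
          (a z * B z + A z * b z) * τ z) / r z ^ 4 +
        3 * (a z * B z + A z * b z) * (p z + q z) ^ 2 / r z ^ 5 := fun z hz => by
    have hd := (dA z hz).mul (dB z hz)
    have he := (da z hz).mul (db z hz)
    have hu := ((da z hz).mul (dB z hz)).add ((dA z hz).mul (db z hz))
    have h0 := hr z hz
    have h1 := (((((dσ z hz).mul hd).div_const 4).add (he.const_mul 2)).div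
      ((dr z hz).pow 2) (pow_ne_zero 2 h0)).add
      ((hu.mul (dσ z hz)).div ((dr z hz).pow 3) (pow_ne_zero 3 h0))
    refine step G2 hz hz.1 (by linarith [hz.2]) (h1.congr_deriv ?_)
    have := hz.1
    simp only [Pi.mul_apply, Pi.add_apply, Pi.pow_apply]
    norm_num
    field_simp
    ring
  have hz : (65 / 1296 : ℝ) ∈ Set.Ioo (0 : ℝ) (1 / 16) := by norm_num
  have hρ : brafmanRho (65 / 1296) = 1199 / 1296 := by
    rw [brafmanRho, show (1 - 38 / 13 * (65 / 1296) + (65 / 1296) ^ 2 : ℝ) = (1199 / 1296) ^ 2 by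
      norm_num, Real.sqrt_sq (by norm_num)]
  have hα : brafmanAlpha (65 / 1296) = 1 / 81 := by rw [brafmanAlpha, hρ]; norm_num
  have hβ : brafmanBeta (65 / 1296) = 1 / 16 := by rw [brafmanBeta, hρ]; norm_num
  have hL := legendreForm_eq (t := 1 / 3) (by norm_num)
  rw [legendreForm, show ((1 / 3 : ℝ)) ^ 4 = 1 / 81 by norm_num,
    show (((1 - 1 / 3) / (1 + 1 / 3)) ^ 4 : ℝ) = 1 / 16 by norm_num] at hL
  have g0 := G0 _ hz
  have g1 := G1 _ hz
  have g2 := G2 _ hz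
  have g3 := G3 _ hz
  simp only [A, B, a, b, τ, p, q, r, hρ, hα, hβ] at g0 g1 g2 g3
  have hs : ∀ k, HasSum (fun n : ℕ => (n : ℝ) ^ k * brafmanCoeff n * (65 / 1296) ^ n)
      (eulerSeries brafmanCoeff k (65 / 1296)) := fun k =>
    (summable_eulerSeries h3 abs_brafmanCoeff_le k (by norm_num [abs_of_pos])).hasSum
  have hsum := ((((hs 3).mul_left 97756868).sub ((hs 2).mul_left 24254580)).sub
    ((hs 1).mul_left 539415)).sub ((hs 0).mul_left 264590)
  have hval : 97756868 * eulerSeries brafmanCoeff 3 (65 / 1296) -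
      24254580 * eulerSeries brafmanCoeff 2 (65 / 1296) -
      539415 * eulerSeries brafmanCoeff 1 (65 / 1296) -
      264590 * eulerSeries brafmanCoeff 0 (65 / 1296) = 6065280 / π := by
    rw [g0, g1, g2, g3]
    linear_combination 6065280 * hL
  have hlim := hsum.tendsto_sum_nat
  rw [hval] at hlim
  refine hlim.congr fun N => Finset.sum_congr rfl fun n _ => ?_
  rw [brafmanCoeff, ellCoeff, ← Nat.centralBinom_eq_two_mul_choose,
    show (65 / 20736 : ℝ) = 65 / 1296 / 16 by norm_num, div_pow (65 / 1296 : ℝ) 16]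
  ring
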